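/- arXiv:hep-th/9503066 — 6 statements merged into one kernel-verified Lean document; each statement's English description precedes it below -/
import Mathlib

section
/- Let A be a Poisson algebra over ℂ, D ⊆ ℂ, η ∈ ℂ, and let a, b, c : D → A be such that b(λ) is invertible for every λ ∈ D and such that the matrix L₀(λ) = [[a(λ), b(λ)],[c(λ), −a(λ)]] satisfies the rational linear r-matrix bracket {L₀(λ) ⊗, L₀(μ)} = [ (η/(λ−μ))·Π, L₀(λ)⊗I + I⊗L₀(μ) ] for all λ ≠ μ in D. Let f : D → ℂ. Then the deformed matrix L(λ) = [[a(λ), b(λ)],[f(λ)·b(λ)⁻¹ + c(λ), −a(λ)]] satisfies the linear rs-matrix algebra {L(λ) ⊗, L(μ)} = [ (η/(λ−μ))·Π, L(λ)⊗I + I⊗L(μ) ] + [ s(λ,μ), L(λ)⊗I − I⊗L(μ) ] for all λ ≠ μ in D, with the dynamical matrix s(λ,μ) = (η/(λ−μ))·( f(λ)b(λ)⁻² − f(μ)b(μ)⁻² )·σ₋⊗σ₋. -/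
open Matrix Kronecker

/-- A Poisson algebra over ℂ. -/
structure PoissonC (A : Type*) [CommRing A] [Algebra ℂ A] where
  br : A → A → A
  add_left : ∀ x y z : A, br (x + y) z = br x z + br y z
  add_right : ∀ x y z : A, br x (y + z) = br x y + br x z
  antisymm : ∀ x y : A, br x y = - br y x
  jacobi : ∀ x y z : A, br x (br y z) + br y (br z x) + br z (br x y) = 0
  leibniz : ∀ x y z : A, br x (y * z) = br x y * z + y * br x z
  scalar : ∀ (c : ℂ) (x : A), br (algebraMap ℂ A c) x = 0

variable {A : Type*} [CommRing A] [Algebra ℂ A]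

/-- The 4×4 permutation (swap) matrix `Π_{(i,k),(j,l)} = δ_{il} δ_{kj}`. -/
def swapM : Matrix (Fin 2 × Fin 2) (Fin 2 × Fin 2) A :=
  Matrix.of fun p q => if p.1 = q.2 ∧ p.2 = q.1 then 1 else 0

/-- σ₋ = [[0,0],[1,0]]. -/
def σm : Matrix (Fin 2) (Fin 2) A := !![0, 0; 1, 0]

/-- Tensor Poisson bracket of two 2×2 matrices. -/
def tbr (P : PoissonC A) (L L' : Matrix (Fin 2) (Fin 2) A) :
    Matrix (Fin 2 × Fin 2) (Fin 2 × Fin 2) A :=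
  Matrix.of fun p q => P.br (L p.1 q.1) (L' p.2 q.2)

/-- Matrix commutator. -/
def mcomm {ι : Type*} [Fintype ι] [DecidableEq ι] (X Y : Matrix ι ι A) : Matrix ι ι A :=
  X * Y - Y * X

namespace PoissonC

variable (P : PoissonC A)

theorem br_scalar (x : A) (r : ℂ) : P.br x (algebraMap ℂ A r) = 0 := by
  rw [P.antisymm, P.scalar, neg_zero]

theorem br_one (x : A) : P.br x 1 = 0 := by
  simpa using P.br_scalar x 1

theorem br_zero (x : A) : P.br x 0 = 0 := by
  simpa using P.br_scalar x 0

theorem br_neg (x y : A) : P.br x (-y) = -P.br x y := by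
  have h := P.add_right x y (-y)
  rw [add_neg_cancel, br_zero] at h
  linear_combination -h

theorem neg_br (x y : A) : P.br (-x) y = -P.br x y := by
  rw [P.antisymm, br_neg, P.antisymm x y]

theorem br_scalar_mul (x y : A) (r : ℂ) :
    P.br x (algebraMap ℂ A r * y) = algebraMap ℂ A r * P.br x y := by
  rw [P.leibniz, br_scalar, zero_mul, zero_add]

theorem scalar_mul_br (x y : A) (r : ℂ) :
    P.br (algebraMap ℂ A r * x) y = algebraMap ℂ A r * P.br x y := by
  rw [P.antisymm, br_scalar_mul, P.antisymm x y, mul_neg]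

theorem br_of_mul_eq_one (x : A) {y u : A} (h : y * u = 1) :
    P.br x u = -(u ^ 2 * P.br x y) := by
  have h1 := P.leibniz x y u
  rw [h, br_one] at h1
  linear_combination (-P.br x u) * h - u * h1

theorem of_mul_eq_one_br (x : A) {y u : A} (h : y * u = 1) :
    P.br u x = -(u ^ 2 * P.br y x) := by
  rw [P.antisymm, P.br_of_mul_eq_one x h, P.antisymm x y, mul_neg, neg_neg]

end PoissonC

/-- The linear bracket with the rational `r`-matrix, written entrywise. -/
theorem mcomm_smul_swapM {R : Type*} [CommRing R] (k : R) (X Y : Matrix (Fin 2) (Fin 2) R)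
    (p q : Fin 2 × Fin 2) :
    mcomm (k • swapM) (X ⊗ₖ (1 : Matrix (Fin 2) (Fin 2) R)
        + (1 : Matrix (Fin 2) (Fin 2) R) ⊗ₖ Y) p q
      = k * ((Y - X) p.1 q.2 * (1 : Matrix (Fin 2) (Fin 2) R) p.2 q.1
        - (1 : Matrix (Fin 2) (Fin 2) R) p.1 q.2 * (Y - X) p.2 q.1) := by
  obtain ⟨i, j⟩ := p
  obtain ⟨i', j'⟩ := q
  fin_cases i <;> fin_cases j <;> fin_cases i' <;> fin_cases j' <;>
    simp [mcomm, swapM, Matrix.mul_apply, Fintype.sum_prod_type] <;> ring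

/-- The commutator with a multiple of `σ₋ ⊗ σ₋`, written entrywise. -/
theorem mcomm_smul_σm {R : Type*} [CommRing R] (t : R) (X Y : Matrix (Fin 2) (Fin 2) R)
    (p q : Fin 2 × Fin 2) :
    mcomm (t • (σm ⊗ₖ σm)) (X ⊗ₖ (1 : Matrix (Fin 2) (Fin 2) R)
        - (1 : Matrix (Fin 2) (Fin 2) R) ⊗ₖ Y) p q
      = t * ((if p = (1, 1) then (if q.2 = 0 then X 0 q.1 else 0)
            - (if q.1 = 0 then Y 0 q.2 else 0) else 0)
        - (if q = (0, 0) then (if p.2 = 1 then X p.1 1 else 0)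
            - (if p.1 = 1 then Y p.2 1 else 0) else 0)) := by
  obtain ⟨i, j⟩ := p
  obtain ⟨i', j'⟩ := q
  fin_cases i <;> fin_cases j <;> fin_cases i' <;> fin_cases j' <;>
    simp [mcomm, σm, Matrix.mul_apply, Fintype.sum_prod_type] <;> ring

/-- the rational (XXX) deformation `L(λ) = L₀(λ) + f(λ)b(λ)⁻¹·σ₋`-type
matrix satisfies the linear `rs`-matrix algebra with dynamical matrix
`s(λ,μ) = (η/(λ−μ))(f(λ)b(λ)⁻² − f(μ)b(μ)⁻²)·σ₋⊗σ₋`. -/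
theorem statement3 (P : PoissonC A) (D : Set ℂ) (η : ℂ)
    (a b c : ℂ → A) (f : ℂ → ℂ)
    (hb : ∀ l ∈ D, IsUnit (b l))
    (L0 : ℂ → Matrix (Fin 2) (Fin 2) A)
    (hL0 : ∀ l, L0 l = !![a l, b l; c l, -a l])
    (h0 : ∀ l ∈ D, ∀ m ∈ D, l ≠ m →
      tbr P (L0 l) (L0 m)
        = mcomm (algebraMap ℂ A (η / (l - m)) • swapM)
            (L0 l ⊗ₖ (1 : Matrix (Fin 2) (Fin 2) A)
              + (1 : Matrix (Fin 2) (Fin 2) A) ⊗ₖ L0 m))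
    (L : ℂ → Matrix (Fin 2) (Fin 2) A)
    (hL : ∀ l, L l = !![a l, b l;
        algebraMap ℂ A (f l) * Ring.inverse (b l) + c l, -a l])
    (s : ℂ → ℂ → Matrix (Fin 2 × Fin 2) (Fin 2 × Fin 2) A)
    (hs : ∀ l m, s l m = (algebraMap ℂ A (η / (l - m)) *
        (algebraMap ℂ A (f l) * Ring.inverse (b l) ^ 2
          - algebraMap ℂ A (f m) * Ring.inverse (b m) ^ 2)) • (σm ⊗ₖ σm)) :
    ∀ l ∈ D, ∀ m ∈ D, l ≠ m →
      tbr P (L l) (L m)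
        = mcomm (algebraMap ℂ A (η / (l - m)) • swapM)
            (L l ⊗ₖ (1 : Matrix (Fin 2) (Fin 2) A)
              + (1 : Matrix (Fin 2) (Fin 2) A) ⊗ₖ L m)
          + mcomm (s l m)
            (L l ⊗ₖ (1 : Matrix (Fin 2) (Fin 2) A)
              - (1 : Matrix (Fin 2) (Fin 2) A) ⊗ₖ L m) := by
  intro l hl m hm hlm
  have hu := Ring.mul_inverse_cancel _ (hb l hl)
  have hv := Ring.mul_inverse_cancel _ (hb m hm)
  have h (i j i' j' : Fin 2) := congrFun (congrFun (h0 l hl m hm hlm) (i, j)) (i', j')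
  simp only [mcomm_smul_swapM, tbr, Matrix.of_apply, hL0] at h
  have haa := h 0 0 0 0
  have hab := h 0 0 0 1
  have hac := h 0 1 0 0
  have hba := h 0 0 1 0
  have hbb := h 0 0 1 1
  have hbc := h 0 1 1 0
  have hca := h 1 0 0 0
  have hcb := h 1 0 0 1
  have hcc := h 1 1 0 0
  clear h
  simp [-map_div₀] at haa hab hac hba hbb hbc hca hcb hcc
  rw [hs, hL, hL]
  generalize algebraMap ℂ A (η / (l - m)) = k at *
  generalize Ring.inverse (b l) = u at *
  generalize Ring.inverse (b m) = v at *
  clear hb hL0 h0 hL hs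
  ext ⟨i, j⟩ ⟨i', j'⟩
  rw [Matrix.add_apply, mcomm_smul_swapM, mcomm_smul_σm]
  fin_cases i <;> fin_cases j <;> fin_cases i' <;> fin_cases j' <;>
    simp [tbr, P.add_left, P.add_right, P.br_neg, P.neg_br, P.br_scalar_mul, P.scalar_mul_br,
      P.br_of_mul_eq_one _ hv, P.of_mul_eq_one_br _ hu, haa, hab, hac, hba, hbb, hbc, hca,
      hcb, hcc] <;>
    grind
end

section
/- Let A be a Poisson algebra and b ∈ A[X] a polynomial all of whose coefficients pairwise Poisson-commute: {b_i, b_j} = 0 for all i, j. Let u, w ∈ A be roots of b in the evaluation sense, b(u) = 0 and b(w) = 0 (where b(u) = Σ_i b_i·u^i), and assume the evaluated derivatives b'(u) and b'(w) are invertible in A. Then every coefficient of b Poisson-commutes with each root, {b_i, u} = 0 and {b_i, w} = 0 for all i, and the roots Poisson-commute: {u, w} = 0. -/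
open Polynomial

/-- A Poisson algebra: a commutative ring with an additive, antisymmetric bracket
satisfying the Jacobi identity and the Leibniz rule. -/
structure PoissonR (A : Type*) [CommRing A] where
  br : A → A → A
  add_left : ∀ x y z : A, br (x + y) z = br x z + br y z
  add_right : ∀ x y z : A, br x (y + z) = br x y + br x z
  antisymm : ∀ x y : A, br x y = - br y x
  jacobi : ∀ x y z : A, br x (br y z) + br y (br z x) + br z (br x y) = 0
  leibniz : ∀ x y z : A, br x (y * z) = br x y * z + y * br x z

namespace PoissonR

variable {A : Type*} [CommRing A] (P : PoissonR A)

/-- The Hamiltonian derivation `y ↦ {x, y}`. -/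
def hamiltonian (x : A) : Derivation ℤ A A :=
  Derivation.mk' (AddMonoidHom.mk' (P.br x) (P.add_right x)).toIntLinearMap fun y z => by
    simp only [AddMonoidHom.coe_toIntLinearMap, AddMonoidHom.mk'_apply, smul_eq_mul, P.leibniz]
    ring

@[simp]
lemma hamiltonian_apply (x y : A) : P.hamiltonian x y = P.br x y := rfl

end PoissonR

/-- A derivation killing the coefficients of a polynomial kills each of its simple roots. -/
lemma Derivation.apply_root_eq_zero {A : Type*} [CommRing A] (D : Derivation ℤ A A) {p : A[X]}
    (hp : ∀ i, D (p.coeff i) = 0) {r : A} (hr : p.eval r = 0)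
    (hr' : IsUnit (p.derivative.eval r)) : D r = 0 := by
  have hmap : D.mapCoeffs p = 0 := by
    ext i
    exact hp i
  have h := D.apply_eval_eq r p
  rw [hr, hmap, map_zero, map_zero, zero_add, smul_eq_mul] at h
  exact hr'.mul_right_eq_zero.mp h.symm

/-- if the coefficients of `b` pairwise Poisson-commute, then every
coefficient commutes with each (nondegenerate) root, and the roots commute. -/
theorem statement8 {A : Type*} [CommRing A] (P : PoissonR A) (b : Polynomial A)
    (hcoef : ∀ i j, P.br (b.coeff i) (b.coeff j) = 0)
    (u w : A) (hu : b.eval u = 0) (hw : b.eval w = 0)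
    (hu' : IsUnit ((Polynomial.derivative b).eval u))
    (hw' : IsUnit ((Polynomial.derivative b).eval w)) :
    (∀ i, P.br (b.coeff i) u = 0) ∧ (∀ i, P.br (b.coeff i) w = 0) ∧ P.br u w = 0 := by
  have hbu : ∀ i, P.br (b.coeff i) u = 0 := fun i =>
    (P.hamiltonian (b.coeff i)).apply_root_eq_zero (hcoef i) hu hu'
  refine ⟨hbu, fun i => (P.hamiltonian (b.coeff i)).apply_root_eq_zero (hcoef i) hw hw', ?_⟩
  refine (P.hamiltonian u).apply_root_eq_zero (fun i => ?_) hw hw'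
  rw [P.hamiltonian_apply, P.antisymm, hbu, neg_zero]
end

section
/- Let A be a Poisson algebra over ℂ, η ∈ ℂ, and let a, b ∈ A[X] satisfy: {b_i, b_j} = 0 for all coefficients of b, and the identity (λ−μ)·{a(λ), b(μ)} = η·(b(μ) − b(λ)) in A[λ,μ] (two-variable coefficientwise bracket). Let u ∈ A with b(u) = 0 and b'(u) invertible, and set v = a(u). Then, as an identity in the polynomial ring A[μ]: (u − μ)·{v, b(μ)} = η·b(μ), where {v, b(μ)} denotes Σ_j {v, b_j}·μ^j and b(μ) = Σ_j b_j μ^j. -/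
open Polynomial

variable {A : Type*} [CommRing A] [Algebra ℂ A]

/-- The two-variable bracket `{p(λ), q(μ)} = Σ_{i,j} {p_i, q_j} λ^i μ^j ∈ A[λ,μ] = (A[μ])[λ]`
(outer variable `λ`, inner variable `μ`). -/
noncomputable def br2 (P : PoissonC A) (p q : Polynomial A) :
    Polynomial (Polynomial A) :=
  ∑ i ∈ p.support, ∑ j ∈ q.support,
    Polynomial.C (Polynomial.C (P.br (p.coeff i) (q.coeff j)) * Polynomial.X ^ j)
      * Polynomial.X ^ i

/-- The one-variable bracket `{x, q(μ)} = Σ_j {x, q_j} μ^j ∈ A[μ]`. -/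
noncomputable def br1 (P : PoissonC A) (x : A) (q : Polynomial A) : Polynomial A :=
  ∑ j ∈ q.support, Polynomial.C (P.br x (q.coeff j)) * Polynomial.X ^ j

namespace PoissonC

lemma br_zero_left (P : PoissonC A) (y : A) : P.br 0 y = 0 := by
  simpa using P.add_left 0 0 y

lemma leibniz_left (P : PoissonC A) (x y z : A) :
    P.br (x * y) z = x * P.br y z + y * P.br x z := by
  rw [P.antisymm, P.leibniz, P.antisymm z x, P.antisymm z y]
  ring

/-- The bracket with a fixed second argument, as a derivation. -/
def brLeft (P : PoissonC A) (w : A) : Derivation ℤ A A :=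
  Derivation.mk'
    (AddMonoidHom.mk' (fun x => P.br x w) fun x y => P.add_left x y w).toIntLinearMap
    fun x y => P.leibniz_left x y w

lemma brLeft_apply (P : PoissonC A) (w x : A) : P.brLeft w x = P.br x w := rfl

lemma br_eval (P : PoissonC A) (p : A[X]) (u w : A) :
    P.br (p.eval u) w
      = ∑ i ∈ p.support, P.br (p.coeff i) w * u ^ i + p.derivative.eval u * P.br u w := by
  rw [derivative_eval, eval_eq_sum]
  simp only [← brLeft_apply, Polynomial.sum, map_sum, Derivation.leibniz,
    Derivation.leibniz_pow, Finset.sum_mul, ← Finset.sum_add_distrib]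
  refine Finset.sum_congr rfl fun i _ => ?_
  simp only [smul_eq_mul, nsmul_eq_mul]
  ring

end PoissonC

/-- for a root `u` of `b` with `b'(u)` invertible and `v = a(u)`,
one has `(u − μ)·{v, b(μ)} = η·b(μ)` in `A[μ]`. -/
theorem statement9 (P : PoissonC A) (η : ℂ) (a b : Polynomial A)
    (hbb : ∀ i j, P.br (b.coeff i) (b.coeff j) = 0)
    (hab : (Polynomial.X - Polynomial.C Polynomial.X) * br2 P a b
      = algebraMap ℂ (Polynomial (Polynomial A)) η
          * (Polynomial.C b - b.map Polynomial.C))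
    (u : A) (hu : b.eval u = 0) (hu' : IsUnit ((Polynomial.derivative b).eval u))
    (v : A) (hv : v = a.eval u) :
    (Polynomial.C u - Polynomial.X) * br1 P v b
      = algebraMap ℂ (Polynomial A) η * b := by
  have hub (j : ℕ) : P.br u (b.coeff j) = 0 := by
    have h := P.br_eval b u (b.coeff j)
    simp only [hu, P.br_zero_left, hbb, zero_mul, Finset.sum_const_zero, zero_add] at h
    exact hu'.mul_right_eq_zero.mp h.symm
  have hbr : br1 P v b = (br2 P a b).eval (C u) := by
    simp only [br1, br2, hv, P.br_eval, hub, mul_zero, add_zero, eval_finsetSum, eval_mul,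
      eval_C, eval_pow, eval_X, map_sum, Finset.sum_mul, map_mul, map_pow]
    rw [Finset.sum_comm]
    refine Finset.sum_congr rfl fun i _ => Finset.sum_congr rfl fun j _ => ?_
    ring
  have h := congrArg (eval (C u)) hab
  have hη : algebraMap ℂ A[X][X] η = C (algebraMap ℂ A[X] η) := rfl
  simpa [hη, ← hbr, eval_map, eval₂_hom, hu] using h
end

section
/- (Key identity for the momentum-dependent canonical transformation.) Let A be a Poisson algebra over ℂ containing elements u₁,…,u_n, v₁,…,v_n with {u_i, u_j} = 0, {v_i, v_j} = 0 and {v_i, u_j} = δ_{ij}. Let f₁,…,f_N ∈ ℂ and set δ_k = Σ_{j=1}^N f_j·u_k^j − v_k² for k = 1,…,n (the value at λ = 0 of the block determinant d_k(λ) = Σ_j f_j(u_k^j − λ^j) − v_k²), and H = Σ_{k=1}^n δ_k. Fix k < n, assume u_{k+1} − u_k is invertible in A, let α ∈ ℂ, and define X_k = α·(δ_k − δ_{k+1})·(u_{k+1} − u_k)⁻¹ and P_k = (v_{k+1} − v_k)·(u_{k+1} − u_k)⁻¹. Then {H, X_k} = 2·P_k·X_k. (With x_k² = X_k and p_k = P_k·x_k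 this is the identity {H, x_k²} = 2·x_k·p_k establishing that the map (u,v) ↦ (x,p) is canonical.) -/
namespace PoissonC

variable {A : Type*} [CommRing A] [Algebra ℂ A] (P : PoissonC A)

/-- The Hamiltonian derivation `{x, ·}` of a Poisson algebra. -/
def ad (x : A) : Derivation ℂ A A :=
  Derivation.mk'
    { toFun := P.br x
      map_add' := P.add_right x
      map_smul' := fun c y => by
        rw [Algebra.smul_def, P.leibniz, P.antisymm x, P.scalar, RingHom.id_apply,
          Algebra.smul_def, neg_zero, zero_mul, zero_add] }
    fun y z => by
      simp only [LinearMap.coe_mk, AddHom.coe_mk, P.leibniz, smul_eq_mul]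
      ring

theorem ad_apply (x y : A) : P.ad x y = P.br x y := rfl

theorem ad_antisymm (x y : A) : P.ad x y = -P.ad y x := P.antisymm x y

theorem ad_self (x : A) : P.ad x x = 0 := by
  have : IsAddTorsionFree A := .of_isTorsionFree ℂ A
  exact self_eq_neg.mp (P.ad_antisymm x x)

theorem ad_sum_left {ι : Type*} (s : Finset ι) (g : ι → A) (y : A) :
    P.ad (∑ i ∈ s, g i) y = ∑ i ∈ s, P.ad (g i) y := by
  simp only [P.ad_antisymm _ y, map_sum, Finset.sum_neg_distrib]

end PoissonC

theorem Derivation.polynomial_sub_sq {A : Type*} [CommRing A] [Algebra ℂ A]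
    (D : Derivation ℂ A A) {N : ℕ} (f : Fin N → ℂ) {a : A} (b : A) (ha : D a = 0) :
    D ((∑ j : Fin N, algebraMap ℂ A (f j) * a ^ ((j : ℕ) + 1)) - b ^ 2) = -(2 * b * D b) := by
  simp [D.leibniz_pow, ha, mul_assoc]

theorem Derivation.leibniz_ringInverse {A : Type*} [CommRing A] [Algebra ℂ A]
    (D : Derivation ℂ A A) {a : A} (ha : IsUnit a) :
    D (Ring.inverse a) = -Ring.inverse a ^ 2 * D a :=
  D.leibniz_of_mul_eq_one (Ring.inverse_mul_cancel a ha)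

/-- the key identity `{H, X_k} = 2·P_k·X_k` for the momentum-dependent
canonical transformation. -/
theorem statement13 {A : Type*} [CommRing A] [Algebra ℂ A] (P : PoissonC A)
    (n N : ℕ) (u v : Fin n → A)
    (huu : ∀ i j, P.br (u i) (u j) = 0)
    (hvv : ∀ i j, P.br (v i) (v j) = 0)
    (hvu : ∀ i j, P.br (v i) (u j) = if i = j then 1 else 0)
    (f : Fin N → ℂ)
    (δ : Fin n → A)
    (hδ : ∀ k, δ k
      = (∑ j : Fin N, algebraMap ℂ A (f j) * u k ^ ((j : ℕ) + 1)) - v k ^ 2)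
    (H : A) (hH : H = ∑ k, δ k)
    (k : ℕ) (hk : k + 1 < n) (α : ℂ)
    (hinv : IsUnit (u ⟨k + 1, hk⟩ - u ⟨k, Nat.lt_of_succ_lt hk⟩))
    (Xk Pk : A)
    (hX : Xk = algebraMap ℂ A α * (δ ⟨k, Nat.lt_of_succ_lt hk⟩ - δ ⟨k + 1, hk⟩)
        * Ring.inverse (u ⟨k + 1, hk⟩ - u ⟨k, Nat.lt_of_succ_lt hk⟩))
    (hP : Pk = (v ⟨k + 1, hk⟩ - v ⟨k, Nat.lt_of_succ_lt hk⟩)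
        * Ring.inverse (u ⟨k + 1, hk⟩ - u ⟨k, Nat.lt_of_succ_lt hk⟩)) :
    P.br H Xk = 2 * Pk * Xk := by
  have ad_u_u (i j) : P.ad (u i) (u j) = 0 := huu i j
  have ad_v_v (i j) : P.ad (v i) (v j) = 0 := hvv i j
  have ad_v_u (i j) : P.ad (v i) (u j) = if i = j then 1 else 0 := hvu i j
  have ad_δ_u (i j) : P.ad (δ i) (u j) = if i = j then -(2 * v i) else 0 := by
    rw [P.ad_antisymm, hδ i, Derivation.polynomial_sub_sq _ f _ (ad_u_u j i),
      P.ad_antisymm, ad_v_u]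
    split_ifs <;> simp
  have ad_δ_v {i j} (hij : i ≠ j) : P.ad (δ i) (v j) = 0 := by
    rw [P.ad_antisymm, hδ i,
      Derivation.polynomial_sub_sq _ f _ ((ad_v_u j i).trans (if_neg hij.symm)), ad_v_v]
    simp
  have ad_δ_δ (i j) : P.ad (δ i) (δ j) = 0 := by
    rcases eq_or_ne i j with rfl | hij
    · exact P.ad_self _
    · rw [hδ j, Derivation.polynomial_sub_sq _ f _ ((ad_δ_u i j).trans (if_neg hij)),
        ad_δ_v hij]
      simp
  have ad_H_u (j) : P.ad H (u j) = -(2 * v j) := by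
    simp [hH, P.ad_sum_left, ad_δ_u]
  have ad_H_δ (j) : P.ad H (δ j) = 0 := by
    simp [hH, P.ad_sum_left, ad_δ_δ]
  rw [← P.ad_apply, hX, hP]
  simp only [Derivation.leibniz, Derivation.leibniz_ringInverse _ hinv, map_sub, ad_H_u, ad_H_δ,
    Derivation.map_algebraMap, smul_eq_mul]
  ring
end

section
/- (Residue brackets underlying the Mittag-Leffler / generalized elliptic coordinates.) Let A be a Poisson algebra over ℂ, η ∈ ℂ, and let Q ∈ ℂ[X] be a monic polynomial with m distinct simple roots e₁,…,e_m ∈ ℂ. Let 𝐀, 𝐁 ∈ A[X] satisfy {𝐁_i, 𝐁_j} = 0 for all coefficients of 𝐁, and, as an identity in A[λ,μ], (λ−μ)·{𝐀(λ), 𝐁(μ)} = η·( 𝐁(μ)·Q(λ) − 𝐁(λ)·Q(μ) ) (this encodes that the rational functions a = 𝐀/Q, b = 𝐁/Q obey the rational r-matrix relation (λ−μ){a(λ),b(μ)} = η(b(μ)−b(λ))). Define the residues a_i = 𝐀(e_i)·Q'(e_i)⁻¹ and b_i = 𝐁(e_i)·Q'(e_i)⁻¹ in A. Then {b_i, b_j}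 = 0 for all i, j, and {a_i, b_j} = η·δ_{ij}·b_i, the Lie–Poisson brackets satisfied by the representations b_j = x_j², a_j = x_j p_j in canonical variables. -/
open Polynomial

variable {A : Type*} [CommRing A] [Algebra ℂ A]

namespace PoissonC

theorem br_algebraMap_right (P : PoissonC A) (x : A) (c : ℂ) :
    P.br x (algebraMap ℂ A c) = 0 := by
  rw [P.antisymm, P.scalar, neg_zero]

theorem br_smul_right (P : PoissonC A) (c : ℂ) (x y : A) : P.br x (c • y) = c • P.br x y := by
  rw [Algebra.smul_def, P.leibniz, P.br_algebraMap_right, zero_mul, zero_add, Algebra.smul_def]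

theorem br_smul_left (P : PoissonC A) (c : ℂ) (x y : A) : P.br (c • x) y = c • P.br x y := by
  rw [P.antisymm, P.br_smul_right, P.antisymm y x, smul_neg, neg_neg]

/-- The Poisson bracket as a `ℂ`-bilinear map. -/
noncomputable def brLinear (P : PoissonC A) : A →ₗ[ℂ] A →ₗ[ℂ] A :=
  LinearMap.mk₂ ℂ P.br P.add_left P.br_smul_left P.add_right P.br_smul_right

theorem br_eval_eval (P : PoissonC A) (p q : Polynomial A) (c d : ℂ) :
    P.br (p.eval (algebraMap ℂ A c)) (q.eval (algebraMap ℂ A d)) =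
      ∑ i ∈ p.support, ∑ j ∈ q.support, c ^ i • d ^ j • P.br (p.coeff i) (q.coeff j) := by
  have h (r : Polynomial A) (z : ℂ) :
      r.eval (algebraMap ℂ A z) = ∑ i ∈ r.support, z ^ i • r.coeff i := by
    simp only [eval_eq_sum, Polynomial.sum, Algebra.smul_def, map_pow, mul_comm]
  change P.brLinear _ _ = _
  rw [h, h]
  simp only [map_sum, map_smul, LinearMap.sum_apply, LinearMap.smul_apply, Finset.smul_sum]
  rw [Finset.sum_comm]
  refine Finset.sum_congr rfl fun i _ => Finset.sum_congr rfl fun j _ => ?_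
  rw [smul_comm]; rfl

theorem evalEval_br2 (P : PoissonC A) (p q : Polynomial A) (c d : ℂ) :
    (br2 P p q).evalEval (algebraMap ℂ A d) (algebraMap ℂ A c) =
      P.br (p.eval (algebraMap ℂ A c)) (q.eval (algebraMap ℂ A d)) := by
  rw [br_eval_eval]
  simp only [br2, evalEval, eval_finsetSum, eval_mul, eval_C, eval_pow, eval_X,
    Algebra.smul_def, map_pow]
  refine Finset.sum_congr rfl fun i _ => Finset.sum_congr rfl fun j _ => ?_
  ring

end PoissonC

/-- residue brackets underlying the generalized elliptic coordinates:
`{b_i, b_j} = 0` and `{a_i, b_j} = η δ_{ij} b_i`. -/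
theorem statement14 (P : PoissonC A) (η : ℂ)
    (m : ℕ) (e : Fin m → ℂ) (he : Function.Injective e)
    (Q : Polynomial ℂ) (hQ : Q = ∏ i : Fin m, (Polynomial.X - Polynomial.C (e i)))
    (AA BB : Polynomial A)
    (hBB : ∀ i j, P.br (BB.coeff i) (BB.coeff j) = 0)
    (hrel : (Polynomial.X - Polynomial.C Polynomial.X) * br2 P AA BB
      = algebraMap ℂ (Polynomial (Polynomial A)) η *
        (Polynomial.C BB * (Q.map (algebraMap ℂ A)).map Polynomial.C
          - BB.map Polynomial.C * Polynomial.C (Q.map (algebraMap ℂ A))))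
    (aR bR : Fin m → A)
    (haR : ∀ i, aR i
      = algebraMap ℂ A (((Polynomial.derivative Q).eval (e i))⁻¹)
        * AA.eval (algebraMap ℂ A (e i)))
    (hbR : ∀ i, bR i
      = algebraMap ℂ A (((Polynomial.derivative Q).eval (e i))⁻¹)
        * BB.eval (algebraMap ℂ A (e i))) :
    (∀ i j, P.br (bR i) (bR j) = 0) ∧
    (∀ i j, P.br (aR i) (bR j) = if i = j then algebraMap ℂ A η * bR i else 0) := by
  have hroot (i : Fin m) : Q.eval (e i) = 0 := by
    rw [hQ, eval_prod]
    exact Finset.prod_eq_zero (Finset.mem_univ i) (by simp)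
  have hder (i : Fin m) : (derivative Q).eval (e i) ≠ 0 := by
    have hsep : Q.Separable := by
      rw [hQ]
      exact separable_prod_X_sub_C_iff.2 he
    exact hsep.eval₂_derivative_ne_zero (RingHom.id ℂ) (hroot i)
  have hmap (R : Polynomial ℂ) (z : ℂ) :
      (R.map (algebraMap ℂ A)).eval (algebraMap ℂ A z) = algebraMap ℂ A (R.eval z) := by
    rw [eval_map_algebraMap, aeval_algebraMap_apply, coe_aeval_eq_eval]
  have hscal (x y : A) (c d : ℂ) :
      P.br (algebraMap ℂ A c * x) (algebraMap ℂ A d * y) = c • d • P.br x y := by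
    rw [← Algebra.smul_def, ← Algebra.smul_def, P.br_smul_left, P.br_smul_right]
  have hη : algebraMap ℂ (Polynomial (Polynomial A)) η = C (C (algebraMap ℂ A η)) := rfl
  refine ⟨fun i j => ?_, fun i j => ?_⟩
  · rw [hbR, hbR, hscal, P.br_eval_eval]
    simp [hBB]
  · rw [haR, hbR, hscal, ← P.evalEval_br2]
    split_ifs with hij
    · subst hij
      have h := congrArg (fun r => (derivative r).evalEval (algebraMap ℂ A (e i))
        (algebraMap ℂ A (e i))) hrel
      simp only [hη, derivative_mul, derivative_sub, derivative_X, derivative_C, derivative_map,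
        evalEval_add, evalEval_sub, evalEval_mul, evalEval_C, evalEval_X, evalEval_map_C, eval_C,
        eval_X, hmap, hroot, map_zero, mul_zero, zero_mul, sub_zero,
        sub_self, one_mul, zero_add, add_zero] at h
      rw [h, hbR, ← Algebra.smul_def, ← Algebra.smul_def, ← Algebra.smul_def,
        mul_comm, ← Algebra.smul_def, smul_smul, smul_smul, smul_smul, smul_smul]
      congr 1
      field_simp [hder i]
    · have h := congrArg (evalEval (algebraMap ℂ A (e j)) (algebraMap ℂ A (e i))) hrel
      simp only [hη, evalEval_sub, evalEval_mul, evalEval_C, evalEval_X, evalEval_map_C,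
        eval_X, hmap, hroot, map_zero, mul_zero, sub_zero] at h
      rw [← map_sub, ← Algebra.smul_def] at h
      have hne : e i - e j ≠ 0 := sub_ne_zero.2 (he.ne hij)
      rw [(smul_eq_zero_iff_right hne).1 h, smul_zero, smul_zero]
end

section
/- (Additive shift of the integrals of motion.) Let A be a commutative ℂ-algebra, s₁, s₂, s₃ ∈ A, and α₁, α₂, α₃, f ∈ ℂ with α₁² + α₂² + α₃² = 0. Assume b̃ = α₁s₁ + α₂s₂ + α₃s₃ is invertible in A. Set L₀ = Σ_{k=1}^3 s_k σ_k and F = Σ_{k=1}^3 α_k·(f/2)·b̃⁻¹·σ_k. Then the determinant of the deformed matrix differs from that of L₀ by the scalar f: det(L₀ + F) = det L₀ − f·1. (Consequently, for spectral-parameter–dependent data the integrals of motion generated by the determinant of the deformed Lax matrix differ from the undeformed ones only by constants.) -/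
open Matrix

variable {A : Type*} [CommRing A] [Algebra ℂ A]

/-- The Pauli matrices σ₁, σ₂, σ₃ regarded as 2×2 matrices over `A`. -/
noncomputable def pauli : Fin 3 → Matrix (Fin 2) (Fin 2) A
  | 0 => !![0, 1; 1, 0]
  | 1 => !![0, algebraMap ℂ A (-Complex.I); algebraMap ℂ A Complex.I, 0]
  | 2 => !![1, 0; 0, -1]

/-- The determinant of `x σ₁ + y σ₂ + z σ₃` is `-(x² + y² + z²)`. -/
theorem det_pauli_combination (x y z : A) :
    (x • pauli 0 + y • pauli 1 + z • pauli 2 : Matrix (Fin 2) (Fin 2) A).det =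
      -(x ^ 2 + y ^ 2 + z ^ 2) := by
  have hI : algebraMap ℂ A Complex.I * algebraMap ℂ A Complex.I = -1 := by
    rw [← map_mul, Complex.I_mul_I, map_neg, map_one]
  simp only [pauli, det_fin_two, Matrix.add_apply, Matrix.smul_apply, of_apply, cons_val',
    cons_val_zero, cons_val_one, cons_val_fin_one, smul_eq_mul, map_neg]
  linear_combination y ^ 2 * hI

/-- the determinant of the deformed matrix `L₀ + F` differs from that of
`L₀` by the additive constant `f`: `det(L₀ + F) = det L₀ − f·1`. -/
theorem statement15 (s1 s2 s3 : A) (a1 a2 a3 f : ℂ)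
    (hα : a1 ^ 2 + a2 ^ 2 + a3 ^ 2 = 0)
    (btil : A)
    (hb : btil = algebraMap ℂ A a1 * s1 + algebraMap ℂ A a2 * s2 + algebraMap ℂ A a3 * s3)
    (hbu : IsUnit btil)
    (L0 F : Matrix (Fin 2) (Fin 2) A)
    (hL0 : L0 = s1 • pauli 0 + s2 • pauli 1 + s3 • pauli 2)
    (hF : F = (algebraMap ℂ A (a1 * (f / 2)) * Ring.inverse btil) • pauli 0
        + (algebraMap ℂ A (a2 * (f / 2)) * Ring.inverse btil) • pauli 1
        + (algebraMap ℂ A (a3 * (f / 2)) * Ring.inverse btil) • pauli 2) :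
    (L0 + F).det = L0.det - algebraMap ℂ A f := by
  have hsum : L0 + F =
      (s1 + algebraMap ℂ A (a1 * (f / 2)) * Ring.inverse btil) • pauli 0
        + (s2 + algebraMap ℂ A (a2 * (f / 2)) * Ring.inverse btil) • pauli 1
        + (s3 + algebraMap ℂ A (a3 * (f / 2)) * Ring.inverse btil) • pauli 2 := by
    rw [hL0, hF]
    module
  have hnull : algebraMap ℂ A a1 ^ 2 + algebraMap ℂ A a2 ^ 2 + algebraMap ℂ A a3 ^ 2 = 0 := by
    simpa using congrArg (algebraMap ℂ A) hα
  have hhalf : algebraMap ℂ A f = 2 * algebraMap ℂ A (f / 2) := by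
    rw [← map_ofNat (algebraMap ℂ A) 2, ← map_mul, mul_div_cancel₀ f two_ne_zero]
  have hinv : btil * Ring.inverse btil = 1 := Ring.mul_inverse_cancel btil hbu
  rw [hsum, hL0, det_pauli_combination, det_pauli_combination, hhalf]
  simp only [map_mul]
  generalize Ring.inverse btil = r at hinv ⊢
  subst hb
  linear_combination (-(algebraMap ℂ A (f / 2) * r) ^ 2) * hnull
    - 2 * algebraMap ℂ A (f / 2) * hinv
end
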